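/- Consider the MDP model {Y ∪ {Δ}, A, p} with Y = [0,1] ∪ {x0}, where [0,1] carries the relative Euclidean topology and x0 ∉ [0,1] is an isolated point of Y, A = {0,1} with the discrete topology, p(Γ|x0,a) = Leb(Γ) for every Borel Γ ⊆ [0,1] and every a (Leb being Lebesgue measure on [0,1]), and p({Δ}|x,a) = 1 for all x ∈ [0,1] and a ∈ {0,1}. Then this MDP model satisfies Condition (S) and is uniformly absorbing with the initial state x0 (hence Π_DM-uniformly absorbing), yet the set D^{Π_DM}_{x0} of occupation measures over the deterministic Markov strategies is not compact in M(Y × A) with respect to the w-topology. -/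

import Mathlib

open MeasureTheory ProbabilityTheory Filter Topology
open scoped ENNReal

noncomputable section

/-! ### General MDP framework

The state space of an absorbing-type MDP model is `X = Y ⊕ Unit`, where `Sum.inr ()` plays
the role of the isolated cemetery point `Δ` and `Y` is embedded via `Sum.inl`.

A history up to stage `n` is `h_n = (x_0, a_1, x_1, …, a_n, x_n)`, which we encode as the
list of pairs `(x_k, a_{k+1})`, `k < n`, together with the last state `x_n`. -/

/-- The space `H_n` of histories up to stage `n`. -/
abbrev Hist (X A : Type*) (n : ℕ) : Type _ := (Fin n → X × A) × X

/-- A strategy: for every `n`, a stochastic (Markov) kernel on `A` given `H_n`,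
prescribing the law of the action `a_{n+1}` given the history `h_n`. -/
def Strategy (X A : Type*) [MeasurableSpace X] [MeasurableSpace A] : Type _ :=
  {π : (n : ℕ) → Kernel (Hist X A n) A // ∀ n, IsMarkovKernel (π n)}

variable {X A Y : Type*} [MeasurableSpace X] [MeasurableSpace A] [MeasurableSpace Y]

/-- The finite-dimensional distributions of the strategic measure `P^π_{x0}`:
`histLaw p π x0 n` is the joint law of `(X_0, A_1, …, A_n, X_n)` under `P^π_{x0}`,
built by the Ionescu-Tulcea recursion. -/
def histLaw (p : Kernel (X × A) X) (π : Strategy X A) (x0 : X) :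
    (n : ℕ) → Measure (Hist X A n)
  | 0 => Measure.dirac (fun i => i.elim0, x0)
  | n + 1 =>
      (histLaw p π x0 n).bind fun h =>
        ((π.1 n) h).bind fun a =>
          (p (h.2, a)).map fun x' => (Fin.snoc h.1 (h.2, a), x')

/-- The law of the pair `(X_n, A_{n+1})` under the strategic measure `P^π_{x0}`. -/
def pairLaw (p : Kernel (X × A) X) (π : Strategy X A) (x0 : X) (n : ℕ) :
    Measure (X × A) :=
  (histLaw p π x0 n).bind fun h => ((π.1 n) h).map fun a => (h.2, a)

/-- The occupation measure `η^π_{x0}` on `Y × A`: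
`η^π_{x0}(dx × da) = Σ_n P^π_{x0}(X_n ∈ dx ∩ Y, A_{n+1} ∈ da)`. -/
def occupation (p : Kernel ((Y ⊕ Unit) × A) (Y ⊕ Unit)) (π : Strategy (Y ⊕ Unit) A)
    (x0 : Y ⊕ Unit) : Measure (Y × A) :=
  Measure.sum fun n => (pairLaw p π x0 n).comap fun ya : Y × A => (Sum.inl ya.1, ya.2)

/-- `P^π_{x0}(X_t ∈ Y)`.  Since the cemetery `Δ` is absorbing, this equals the tail
probability `P^π_{x0}(τ > t)` of the hitting time `τ` of `Δ`. -/
def survive (p : Kernel ((Y ⊕ Unit) × A) (Y ⊕ Unit)) (π : Strategy (Y ⊕ Unit) A)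
    (x0 : Y ⊕ Unit) (t : ℕ) : ℝ≥0∞ :=
  pairLaw p π x0 t {z | ∃ y : Y, z.1 = Sum.inl y}

/-- The model is absorbing with initial state `x0`:
`E^π_{x0}[τ] = Σ_t P^π_{x0}(τ > t) < ∞` for every strategy `π`. -/
def IsAbsorbing (p : Kernel ((Y ⊕ Unit) × A) (Y ⊕ Unit)) (x0 : Y ⊕ Unit) : Prop :=
  ∀ π : Strategy (Y ⊕ Unit) A, ∑' t : ℕ, survive p π x0 t < ⊤

/-- The model is `Λ`-uniformly absorbing with initial state `x0`:
`sup_{π ∈ Λ} E^π_{x0}[Σ_{t=n}^∞ 1{τ > t}] = sup_{π ∈ Λ} Σ_{t ≥ n} P^π_{x0}(τ > t) → 0`. -/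
def IsUnifAbsorbing (p : Kernel ((Y ⊕ Unit) × A) (Y ⊕ Unit))
    (Λ : Set (Strategy (Y ⊕ Unit) A)) (x0 : Y ⊕ Unit) : Prop :=
  Tendsto (fun n : ℕ => ⨆ π ∈ Λ, ∑' t : ℕ, survive p π x0 (n + t)) atTop (𝓝 0)

/-- The set `D^Λ_{x0} ⊆ M(Y × A)` of occupation measures of strategies in `Λ`. -/
def OccSet (p : Kernel ((Y ⊕ Unit) × A) (Y ⊕ Unit)) (Λ : Set (Strategy (Y ⊕ Unit) A))
    (x0 : Y ⊕ Unit) : Set (FiniteMeasure (Y × A)) :=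
  {η | ∃ π ∈ Λ, (η : Measure (Y × A)) = occupation p π x0}

/-- Condition (S): the action space is compact and `a ↦ ∫ g dp(·|x,a)` is continuous for
every bounded measurable `g` and every state `x`. -/
def ConditionS [TopologicalSpace A] (p : Kernel (X × A) X) : Prop :=
  CompactSpace A ∧
    ∀ g : X → ℝ, Measurable g → (∃ C, ∀ x, |g x| ≤ C) →
      ∀ x : X, Continuous fun a : A => ∫ y, g y ∂(p (x, a))

/-- Condition (W): the action space is compact and `(x,a) ↦ ∫ g dp(·|x,a)` is continuous for
every bounded continuous `g`. -/
def ConditionW [TopologicalSpace X] [TopologicalSpace A] (p : Kernel (X × A) X) : Prop :=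
  CompactSpace A ∧
    ∀ g : X → ℝ, Continuous g → (∃ C, ∀ x, |g x| ≤ C) →
      Continuous fun xa : X × A => ∫ y, g y ∂(p xa)

/-- The w-topology on `M(Ω)`: the coarsest topology making `η ↦ ∫ g dη` continuous for
every bounded continuous `g : Ω → ℝ`. -/
def wTop (Ω : Type*) [TopologicalSpace Ω] [MeasurableSpace Ω] :
    TopologicalSpace (FiniteMeasure Ω) :=
  ⨅ (g : Ω → ℝ) (_ : Continuous g) (_ : ∃ C, ∀ z, |g z| ≤ C),
    TopologicalSpace.induced (fun η : FiniteMeasure Ω => ∫ z, g z ∂(η : Measure Ω))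
      inferInstance

/-- The ws-topology on `M(Y × A)`: the coarsest topology making `η ↦ ∫ g dη` continuous for
every bounded Caratheodory function `g : Y × A → ℝ`. -/
def wsTop (Y A : Type*) [MeasurableSpace Y] [TopologicalSpace A] [MeasurableSpace A] :
    TopologicalSpace (FiniteMeasure (Y × A)) :=
  ⨅ (g : Y × A → ℝ) (_ : Measurable g) (_ : ∃ C, ∀ z, |g z| ≤ C)
    (_ : ∀ y : Y, Continuous fun a : A => g (y, a)),
    TopologicalSpace.induced (fun η : FiniteMeasure (Y × A) => ∫ z, g z ∂(η : Measure (Y × A)))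
      inferInstance

/-- The s-topology on `M(Y)`: the coarsest topology making `η ↦ ∫ f dη` continuous for
every bounded measurable `f : Y → ℝ`. -/
def sTop (Y : Type*) [MeasurableSpace Y] : TopologicalSpace (FiniteMeasure Y) :=
  ⨅ (f : Y → ℝ) (_ : Measurable f) (_ : ∃ C, ∀ z, |f z| ≤ C),
    TopologicalSpace.induced (fun η : FiniteMeasure Y => ∫ z, f z ∂(η : Measure Y))
      inferInstance



/-! ### The concrete example of Remark 1:
`Y = [0,1] ∪ {x₀}` with `x₀` an isolated point (here `Y := ↥(Set.Icc 0 1) ⊕ Unit`,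
`x₀ := Sum.inr ()`), actions `A = {0,1}` (here `Bool`, discrete). -/

/-- The state space of the example: `([0,1] ∪ {x₀}) ∪ {Δ}`. -/
abbrev X5 : Type := (↥(Set.Icc (0:ℝ) 1) ⊕ Unit) ⊕ Unit

/-- The initial state `x₀`, the isolated point of `Y`. -/
def x05 : X5 := Sum.inl (Sum.inr ())

/-- The set `Π_DM` of deterministic Markov strategies: at each stage `n` the action is
`ψ_n(x_{n-1})` for a measurable map `ψ_n : X → A`. -/
def DetMarkov : Set (Strategy X5 Bool) :=
  {π | ∀ n, ∃ ψ : X5 → Bool, Measurable ψ ∧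
    ∀ h : Hist X5 Bool n, (π.1 n) h = Measure.dirac (ψ h.2)}

section General

theorem measurable_snoc_hist (n : ℕ) :
    Measurable fun z : (Hist X A n × A) × X =>
      ((Fin.snoc z.1.1.1 (z.1.1.2, z.1.2), z.2) : Hist X A (n + 1)) := by
  refine Measurable.prodMk (measurable_pi_iff.2 fun i => ?_) measurable_snd
  induction i using Fin.lastCases with
  | last => simp only [Fin.snoc_last]; fun_prop
  | cast i => simp only [Fin.snoc_castSucc]; fun_prop

theorem measurable_histStep (p : Kernel (X × A) X) [IsMarkovKernel p] (n : ℕ) :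
    Measurable fun z : Hist X A n × A =>
      (p (z.1.2, z.2)).map fun x' => ((Fin.snoc z.1.1 (z.1.2, z.2), x') : Hist X A (n + 1)) := by
  refine Measure.measurable_of_measurable_coe _ fun s hs => ?_
  have hf := measurable_snoc_hist (X := X) (A := A) n
  have hq : Measurable fun z : Hist X A n × A => (z.1.2, z.2) := by fun_prop
  have h := Kernel.measurable_kernel_prodMk_left (κ := p.comap _ hq) (hf hs)
  convert h using 2 with z
  exact Measure.map_apply (hf.comp (measurable_prodMk_left (x := z))) hs

theorem measurable_histBind (p : Kernel (X × A) X) [IsMarkovKernel p] (π : Strategy X A) (n : ℕ) :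
    Measurable fun h : Hist X A n => ((π.1 n) h).bind fun a =>
      (p (h.2, a)).map fun x' => ((Fin.snoc h.1 (h.2, a), x') : Hist X A (n + 1)) := by
  have := π.2 n
  refine Measure.measurable_of_measurable_coe _ fun s hs => ?_
  have hm := measurable_histStep p n
  have h := Measurable.lintegral_kernel_prod_right' (κ := π.1 n) ((Measure.measurable_coe hs).comp hm)
  convert h using 2 with z
  exact Measure.bind_apply hs (hm.comp (measurable_prodMk_left (x := z))).aemeasurable

theorem lintegral_histLaw_succ (p : Kernel (X × A) X) [IsMarkovKernel p] (π : Strategy X A)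
    (x0 : X) (n : ℕ) {f : Hist X A (n + 1) → ℝ≥0∞} (hf : Measurable f) :
    ∫⁻ h, f h ∂(histLaw p π x0 (n + 1)) =
      ∫⁻ h, ∫⁻ a, ∫⁻ x', f (Fin.snoc h.1 (h.2, a), x') ∂(p (h.2, a)) ∂(π.1 n h)
        ∂(histLaw p π x0 n) := by
  rw [histLaw, Measure.lintegral_bind (measurable_histBind p π n).aemeasurable hf.aemeasurable]
  refine lintegral_congr fun h => ?_
  refine (Measure.lintegral_bind
    ((measurable_histStep p n).comp (measurable_prodMk_left (x := h))).aemeasurable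
    hf.aemeasurable).trans (lintegral_congr fun a => ?_)
  exact lintegral_map hf ((measurable_snoc_hist n).comp (measurable_prodMk_left (x := (h, a))))

theorem lintegral_histLaw_succ_snd (p : Kernel (X × A) X) [IsMarkovKernel p] (π : Strategy X A)
    (x0 : X) (n : ℕ) {f : X → ℝ≥0∞} (hf : Measurable f) :
    ∫⁻ h, f h.2 ∂(histLaw p π x0 (n + 1)) =
      ∫⁻ h, ∫⁻ a, ∫⁻ x', f x' ∂(p (h.2, a)) ∂(π.1 n h) ∂(histLaw p π x0 n) :=
  lintegral_histLaw_succ p π x0 n (hf.comp measurable_snd)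

theorem lintegral_pairLaw (p : Kernel (X × A) X) (π : Strategy X A)
    (x0 : X) (n : ℕ) {f : X × A → ℝ≥0∞} (hf : Measurable f) :
    ∫⁻ z, f z ∂(pairLaw p π x0 n) =
      ∫⁻ h, ∫⁻ a, f (h.2, a) ∂(π.1 n h) ∂(histLaw p π x0 n) := by
  have := π.2 n
  have hm : Measurable fun h : Hist X A n => ((π.1 n) h).map fun a => (h.2, a) := by
    refine Measure.measurable_of_measurable_coe _ fun s hs => ?_
    have hg : Measurable fun z : Hist X A n × A => (z.1.2, z.2) := by fun_prop
    have h := Kernel.measurable_kernel_prodMk_left (κ := π.1 n) (hg hs)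
    convert h using 2 with z
    rw [Measure.map_apply measurable_prodMk_left hs]
    rfl
  rw [pairLaw, Measure.lintegral_bind hm.aemeasurable hf.aemeasurable]
  exact lintegral_congr fun h => lintegral_map hf measurable_prodMk_left

theorem histLaw_univ (p : Kernel (X × A) X) [IsMarkovKernel p] (π : Strategy X A) (x0 : X)
    (n : ℕ) : histLaw p π x0 n Set.univ = 1 := by
  induction n with
  | zero => simp [histLaw]
  | succ n ih =>
    have := π.2 n
    have h := lintegral_histLaw_succ p π x0 n (f := fun _ => 1) measurable_const
    simpa [ih] using h

theorem pairLaw_univ (p : Kernel (X × A) X) [IsMarkovKernel p] (π : Strategy X A) (x0 : X)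
    (n : ℕ) : pairLaw p π x0 n Set.univ = 1 := by
  have := π.2 n
  have h := lintegral_pairLaw p π x0 n (f := fun _ => 1) measurable_const
  simpa [histLaw_univ] using h

end General

section Oscillation

/-- The square wave of period `2`, with values in `{1, -1}`. -/
def squareWave (x : ℝ) : ℝ := if Even ⌊x⌋ then 1 else -1

theorem measurable_squareWave : Measurable squareWave :=
  Measurable.ite (Int.measurable_floor (MeasurableSet.of_discrete (s := {n : ℤ | Even n})))
    measurable_const measurable_const

theorem squareWave_add_one (x : ℝ) : squareWave (x + 1) = -squareWave x := by
  by_cases h : Even ⌊x⌋ <;> simp [squareWave, h]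

theorem abs_squareWave (x : ℝ) : |squareWave x| = 1 := by
  unfold squareWave; split_ifs <;> simp

theorem tendsto_integral_mul_squareWave {f : ℝ → ℝ} (hf : Continuous f) {C : ℝ}
    (hC : ∀ x, |f x| ≤ C) :
    Tendsto (fun k : ℕ => ∫ t in Set.Icc (0:ℝ) 1, f t * squareWave ((k + 1 : ℝ) * t))
      atTop (𝓝 0) := by
  set F : ℝ → ℝ := (Set.Icc (0:ℝ) 1).indicator f with hF
  have hFm : Measurable F := hf.measurable.indicator measurableSet_Icc
  have hC0 : 0 ≤ C := (abs_nonneg _).trans (hC 0)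
  have hFb : ∀ x, |F x| ≤ (Set.Icc (0:ℝ) 1).indicator (fun _ => C) x := by
    intro x
    by_cases hx : x ∈ Set.Icc (0:ℝ) 1
    · simp only [hF, Set.indicator_of_mem hx]; exact hC x
    · simp only [hF, Set.indicator_of_notMem hx]; simp
  have hFi : Integrable F := by
    refine Integrable.mono' (g := (Set.Icc (0:ℝ) 1).indicator (fun _ => C)) ?_
      hFm.aestronglyMeasurable (.of_forall hFb)
    exact (integrable_indicator_iff measurableSet_Icc).2 (by simp)
  have hw : ∀ k : ℕ, Measurable fun t : ℝ => squareWave ((k + 1 : ℝ) * t) := fun k =>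
    measurable_squareWave.comp (measurable_const_mul _)
  have hbd : ∀ (k : ℕ) {G : ℝ → ℝ}, Integrable G →
      Integrable fun t => G t * squareWave ((k + 1 : ℝ) * t) := fun k G hG =>
    hG.mul_bdd (c := 1) (hw k).aestronglyMeasurable
      (.of_forall fun t => by rw [Real.norm_eq_abs, abs_squareWave])
  have key : ∀ k : ℕ, ∫ t in Set.Icc (0:ℝ) 1, f t * squareWave ((k + 1 : ℝ) * t) =
      2⁻¹ * ∫ t, (F t - F (t - 1 / (k + 1 : ℝ))) * squareWave ((k + 1 : ℝ) * t) := by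
    intro k
    have hk : (k + 1 : ℝ) ≠ 0 := by positivity
    have h1 : ∫ t in Set.Icc (0:ℝ) 1, f t * squareWave ((k + 1 : ℝ) * t) =
        ∫ t, F t * squareWave ((k + 1 : ℝ) * t) := by
      rw [← integral_indicator measurableSet_Icc]
      congr with t
      simp only [hF, Set.indicator]; split_ifs <;> simp
    have h2 : ∫ t, F (t - 1 / (k + 1 : ℝ)) * squareWave ((k + 1 : ℝ) * t) =
        -∫ t, F t * squareWave ((k + 1 : ℝ) * t) := by
      rw [← integral_neg,
        ← integral_sub_right_eq_self (fun t => -(F t * squareWave ((k + 1 : ℝ) * t)))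
          (1 / (k + 1 : ℝ))]
      congr with t
      have := squareWave_add_one ((k + 1 : ℝ) * (t - 1 / (k + 1 : ℝ)))
      rw [show (k + 1 : ℝ) * (t - 1 / (k + 1 : ℝ)) + 1 = (k + 1 : ℝ) * t by
        field_simp; ring] at this
      rw [this]; ring
    simp only [sub_mul]
    rw [integral_sub (hbd k hFi) (hbd k (hFi.comp_sub_right _)), h2, h1]
    ring
  have hlim : Tendsto (fun k : ℕ =>
      ∫ t, (F t - F (t - 1 / (k + 1 : ℝ))) * squareWave ((k + 1 : ℝ) * t)) atTop (𝓝 0) := by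
    rw [show (0:ℝ) = ∫ _ : ℝ, (0:ℝ) by simp]
    refine tendsto_integral_of_dominated_convergence
      ((Set.Icc (0:ℝ) 2).indicator fun _ => 2 * C) (fun k => ?_) ?_ (fun k => ?_) ?_
    · exact ((hFm.sub (hFm.comp (measurable_id.sub_const _))).mul (hw k)).aestronglyMeasurable
    · exact (integrable_indicator_iff measurableSet_Icc).2 (integrableOn_const (by simp))
    · refine .of_forall fun t => ?_
      rw [norm_mul, Real.norm_eq_abs, Real.norm_eq_abs, abs_squareWave, mul_one]
      have h1 := hFb t
      have h2 := hFb (t - 1 / (k + 1 : ℝ))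
      have h3 := abs_sub (F t) (F (t - 1 / (k + 1 : ℝ)))
      have h4 : 0 < 1 / (k + 1 : ℝ) := by positivity
      have h5 : 1 / (k + 1 : ℝ) ≤ 1 := by
        rw [div_le_one (by positivity)]; have : (0:ℝ) ≤ k := by positivity
        linarith
      simp only [Set.indicator, Set.mem_Icc] at h1 h2 ⊢
      split_ifs at h1 h2 ⊢ <;> first | linarith | (exfalso; grind)
    · have hne : ∀ᵐ t : ℝ, t ≠ 0 ∧ t ≠ 1 := by
        have h0 : ∀ᵐ t : ℝ, t ≠ 0 := Measure.ae_ne volume 0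
        have h1 : ∀ᵐ t : ℝ, t ≠ 1 := Measure.ae_ne volume 1
        exact h0.and h1
      filter_upwards [hne] with t ht
      have hc : ContinuousAt F t := by
        refine hf.continuousOn.continuousAt_indicator ?_
        rw [frontier_Icc zero_le_one]
        simpa using ht
      have hs : Tendsto (fun k : ℕ => t - 1 / (k + 1 : ℝ)) atTop (𝓝 t) := by
        simpa using tendsto_const_nhds.sub (tendsto_one_div_add_atTop_nhds_zero_nat (𝕜 := ℝ))
      have hd : Tendsto (fun k : ℕ => F t - F (t - 1 / (k + 1 : ℝ))) atTop (𝓝 0) := by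
        simpa using (tendsto_const_nhds (x := F t)).sub (hc.tendsto.comp hs)
      refine squeeze_zero_norm (fun k => ?_) (norm_zero (E := ℝ) ▸ hd.norm)
      rw [norm_mul, Real.norm_eq_abs (squareWave _), abs_squareWave, mul_one]
  simp only [key]
  simpa using hlim.const_mul 2⁻¹

end Oscillation

section Example

instance {α β : Type*} [MeasurableSpace α] [MeasurableSpace β] [MeasurableSingletonClass α]
    [MeasurableSingletonClass β] : MeasurableSingletonClass (α ⊕ β) where
  measurableSet_singleton := by
    rintro (a | b)
    · simpa using (measurableSet_singleton a).inl_image (β := β)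
    · simpa using (measurableSet_singleton b).inr_image (α := α)

theorem lintegral_eq_of_singleton {α : Type*} [MeasurableSpace α] [MeasurableSingletonClass α]
    {μ : Measure α} [IsProbabilityMeasure μ] {c : α} (h : μ {c} = 1) (f : α → ℝ≥0∞) :
    ∫⁻ x, f x ∂μ = f c := by
  have hae : ∀ᵐ x ∂μ, x = c := (prob_compl_eq_zero_iff (measurableSet_singleton c)).2 h
  rw [lintegral_congr_ae (g := fun _ => f c) (hae.mono fun x hx => by simp [hx])]
  simp

theorem lintegral_histLaw_zero {p : Kernel (X5 × Bool) X5} (π : Strategy X5 Bool) {f : Hist X5 Bool 0 → ℝ≥0∞}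
    (hf : Measurable f) :
    ∫⁻ h, f h ∂(histLaw p π x05 0) = f (fun i => i.elim0, x05) := by
  rw [histLaw, lintegral_dirac' _ hf]

theorem singleton_cemetery_eq_one {p : Kernel (X5 × Bool) X5}
    (hIcc : ∀ (t : ↥(Set.Icc (0:ℝ) 1)) (a : Bool),
      p (Sum.inl (Sum.inl t), a) {(Sum.inr () : X5)} = 1)
    (hcem : ∀ a : Bool, p ((Sum.inr () : X5), a) {(Sum.inr () : X5)} = 1)
    {x : X5} (hx : x ≠ x05) (a : Bool) : p (x, a) {(Sum.inr () : X5)} = 1 := by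
  rcases x with (t | ⟨⟩) | ⟨⟩
  · exact hIcc t a
  · exact absurd rfl hx
  · exact hcem a

theorem lintegral_pairLaw_deterministic {p : Kernel (X5 × Bool) X5} {π : Strategy X5 Bool} {n : ℕ} {ψ : X5 → Bool}
    (hπ : ∀ h : Hist X5 Bool n, (π.1 n) h = Measure.dirac (ψ h.2))
    {f : X5 × Bool → ℝ≥0∞} (hf : Measurable f) :
    ∫⁻ z, f z ∂(pairLaw p π x05 n) = ∫⁻ h, f (h.2, ψ h.2) ∂(histLaw p π x05 n) := by
  rw [lintegral_pairLaw p π x05 n hf]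
  refine lintegral_congr fun h => ?_
  rw [hπ]
  exact lintegral_dirac' _ (hf.comp (measurable_prodMk_left (x := h.2)))

theorem isUnifAbsorbing_of_survive_add_two {p : Kernel (X5 × Bool) X5}
    (h : ∀ (π : Strategy X5 Bool) (n : ℕ), survive p π x05 (n + 2) = 0)
    (Λ : Set (Strategy X5 Bool)) : IsUnifAbsorbing p Λ x05 := by
  refine tendsto_const_nhds.congr' ?_
  filter_upwards [eventually_ge_atTop 2] with n hn
  obtain ⟨m, rfl⟩ := Nat.exists_eq_add_of_le' hn
  have : ∀ (π : Strategy X5 Bool) (t : ℕ), survive p π x05 (m + 2 + t) = 0 := fun π t => by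
    rw [show m + 2 + t = m + t + 2 by ring, h]
  simp [this]

variable {p : Kernel (X5 × Bool) X5} [IsMarkovKernel p]

theorem lintegral_histLaw_one
    (hx0 : ∀ a : Bool, p (x05, a) =
      (volume : Measure (Set.Icc (0:ℝ) 1)).map (fun t => (Sum.inl (Sum.inl t) : X5)))
    (π : Strategy X5 Bool) {f : X5 → ℝ≥0∞} (hf : Measurable f) :
    ∫⁻ h, f h.2 ∂(histLaw p π x05 1) =
      ∫⁻ t : Set.Icc (0:ℝ) 1, f (Sum.inl (Sum.inl t)) := by
  have := π.2 0
  have hae : ∀ᵐ h ∂(histLaw p π x05 0), h.2 = x05 := by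
    rw [histLaw]
    exact (ae_dirac_iff (measurable_snd (measurableSet_singleton x05))).2 rfl
  rw [lintegral_histLaw_succ_snd p π x05 0 hf,
    lintegral_congr_ae (g := fun _ => ∫⁻ t : Set.Icc (0:ℝ) 1, f (Sum.inl (Sum.inl t)))]
  · simp [histLaw_univ]
  · filter_upwards [hae] with h hh
    have hm : Measurable fun t : Set.Icc (0:ℝ) 1 => (Sum.inl (Sum.inl t) : X5) := by fun_prop
    simp only [hh, hx0, lintegral_map hf hm, lintegral_const, measure_univ, mul_one]

theorem lintegral_histLaw_succ_of_ae_ne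
    (hΔ : ∀ x : X5, x ≠ x05 → ∀ a : Bool, p (x, a) {(Sum.inr () : X5)} = 1)
    (π : Strategy X5 Bool) {n : ℕ} (hn : ∀ᵐ h ∂(histLaw p π x05 n), h.2 ≠ x05)
    {f : X5 → ℝ≥0∞} (hf : Measurable f) :
    ∫⁻ h, f h.2 ∂(histLaw p π x05 (n + 1)) = f (Sum.inr ()) := by
  have := π.2 n
  rw [lintegral_histLaw_succ_snd p π x05 n hf,
    lintegral_congr_ae (g := fun _ => f (Sum.inr ()))]
  · simp [histLaw_univ]
  · filter_upwards [hn] with h hh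
    simp only [lintegral_eq_of_singleton (hΔ h.2 hh _), lintegral_const, measure_univ, mul_one]

theorem ae_histLaw_ne
    (hx0 : ∀ a : Bool, p (x05, a) =
      (volume : Measure (Set.Icc (0:ℝ) 1)).map (fun t => (Sum.inl (Sum.inl t) : X5)))
    (hΔ : ∀ x : X5, x ≠ x05 → ∀ a : Bool, p (x, a) {(Sum.inr () : X5)} = 1)
    (π : Strategy X5 Bool) (n : ℕ) : ∀ᵐ h ∂(histLaw p π x05 (n + 1)), h.2 ≠ x05 := by
  have hf : Measurable (({x05} : Set X5).indicator (fun _ => (1 : ℝ≥0∞))) :=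
    measurable_const.indicator (measurableSet_singleton x05)
  suffices h : ∫⁻ h, ({x05} : Set X5).indicator (fun _ => (1 : ℝ≥0∞)) h.2
      ∂(histLaw p π x05 (n + 1)) = 0 by
    replace h := (lintegral_eq_zero_iff (hf.comp measurable_snd)).1 h
    filter_upwards [h] with z hz hz'
    simp [hz'] at hz
  induction n with
  | zero => rw [lintegral_histLaw_one hx0 π hf]; simp [x05]
  | succ n ih =>
    rw [lintegral_histLaw_succ_of_ae_ne hΔ π _ hf]
    · simp [x05]
    · replace ih := (lintegral_eq_zero_iff (hf.comp measurable_snd)).1 ih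
      filter_upwards [ih] with z hz hz'
      simp [hz'] at hz

theorem lintegral_histLaw_add_two
    (hx0 : ∀ a : Bool, p (x05, a) =
      (volume : Measure (Set.Icc (0:ℝ) 1)).map (fun t => (Sum.inl (Sum.inl t) : X5)))
    (hΔ : ∀ x : X5, x ≠ x05 → ∀ a : Bool, p (x, a) {(Sum.inr () : X5)} = 1)
    (π : Strategy X5 Bool) (n : ℕ) {f : X5 → ℝ≥0∞} (hf : Measurable f) :
    ∫⁻ h, f h.2 ∂(histLaw p π x05 (n + 2)) = f (Sum.inr ()) :=
  lintegral_histLaw_succ_of_ae_ne hΔ π (ae_histLaw_ne hx0 hΔ π n) hf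

theorem survive_add_two
    (hx0 : ∀ a : Bool, p (x05, a) =
      (volume : Measure (Set.Icc (0:ℝ) 1)).map (fun t => (Sum.inl (Sum.inl t) : X5)))
    (hΔ : ∀ x : X5, x ≠ x05 → ∀ a : Bool, p (x, a) {(Sum.inr () : X5)} = 1)
    (π : Strategy X5 Bool) (n : ℕ) : survive p π x05 (n + 2) = 0 := by
  have := π.2 (n + 2)
  set S : Set X5 := Set.range Sum.inl
  have hS : MeasurableSet S := measurableSet_range_inl
  have hset : {z : X5 × Bool | ∃ y, z.1 = Sum.inl y} = Prod.fst ⁻¹' S := by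
    ext z; simp [S, eq_comm]
  have hf : Measurable (S.indicator (fun _ => (1 : ℝ≥0∞))) := measurable_const.indicator hS
  rw [survive, hset, ← lintegral_indicator_one (measurable_fst hS)]
  change ∫⁻ z : X5 × Bool, S.indicator (fun _ => 1) z.1 ∂_ = 0
  refine (lintegral_pairLaw p π x05 _ (hf.comp measurable_fst)).trans ?_
  simp only [Function.comp, lintegral_const, measure_univ, mul_one]
  rw [lintegral_histLaw_add_two hx0 hΔ π n hf]
  simp [S]

theorem survive_le_one (π : Strategy X5 Bool) (n : ℕ) : survive p π x05 n ≤ 1 :=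
  (measure_mono (Set.subset_univ _)).trans (pairLaw_univ p π x05 n).le

/-- The occupation measure of a deterministic Markov strategy which plays the action `b` at the
initial state and then acts on `[0,1]` according to `φ`. -/
def graphOccupation (b : Bool) (φ : Set.Icc (0:ℝ) 1 → Bool) :
    Measure ((Set.Icc (0:ℝ) 1 ⊕ Unit) × Bool) :=
  Measure.dirac (Sum.inr (), b) + (volume : Measure (Set.Icc (0:ℝ) 1)).map fun t => (Sum.inl t, φ t)

theorem occupation_eq_graphOccupation
    (hx0 : ∀ a : Bool, p (x05, a) =
      (volume : Measure (Set.Icc (0:ℝ) 1)).map (fun t => (Sum.inl (Sum.inl t) : X5)))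
    (hΔ : ∀ x : X5, x ≠ x05 → ∀ a : Bool, p (x, a) {(Sum.inr () : X5)} = 1)
    {π : Strategy X5 Bool} {ψ : ℕ → X5 → Bool} (hψ : ∀ n, Measurable (ψ n))
    (hπ : ∀ n, ∀ h : Hist X5 Bool n, (π.1 n) h = Measure.dirac (ψ n h.2)) :
    occupation p π x05 =
      graphOccupation (ψ 0 x05) fun t => ψ 1 (Sum.inl (Sum.inl t)) := by
  set e : (Set.Icc (0:ℝ) 1 ⊕ Unit) × Bool → X5 × Bool := fun ya => (Sum.inl ya.1, ya.2)
  have hinj : Function.Injective e := by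
    rintro ⟨y, a⟩ ⟨y', a'⟩ h
    simpa [e] using h
  have hemb : MeasurableEmbedding e :=
    MeasurableEmbedding.prodMap
      ⟨Sum.inl_injective, measurable_inl, fun _ h => h.inl_image⟩ .id
  ext s hs
  have hes : MeasurableSet (e '' s) := hemb.measurableSet_image.2 hs
  set f : X5 × Bool → ℝ≥0∞ := (e '' s).indicator 1 with hfdef
  have hf : Measurable f := measurable_one.indicator hes
  have hfe : ∀ y a, f (Sum.inl y, a) = s.indicator 1 (y, a) := fun y a => by
    by_cases h : (y, a) ∈ s
    · rw [Set.indicator_of_mem h, hfdef, Set.indicator_of_mem (show (Sum.inl y, a) ∈ e '' s from ⟨_, h, rfl⟩)]; rfl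
    · rw [Set.indicator_of_notMem h, hfdef, Set.indicator_of_notMem]
      rintro ⟨z, hz, hz'⟩
      exact h (hinj (a₂ := (y, a)) hz' ▸ hz)
  have hterm : ∀ n, (pairLaw p π x05 n).comap e s =
      ∫⁻ h, f (h.2, ψ n h.2) ∂(histLaw p π x05 n) := fun n => by
    rw [hemb.comap_apply, ← lintegral_indicator_one hes]
    exact lintegral_pairLaw_deterministic (hπ n) hf
  have hfψ : ∀ n, Measurable fun x => f (x, ψ n x) := fun n =>
    hf.comp (measurable_id.prodMk (hψ n))
  have h0 : (pairLaw p π x05 0).comap e s = s.indicator 1 (Sum.inr (), ψ 0 x05) := by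
    rw [hterm, ← hfe]
    exact lintegral_histLaw_zero π ((hfψ 0).comp measurable_snd)
  have hφ : Measurable fun t : Set.Icc (0:ℝ) 1 =>
      ((Sum.inl t, ψ 1 (Sum.inl (Sum.inl t))) : (Set.Icc (0:ℝ) 1 ⊕ Unit) × Bool) :=
    measurable_inl.prodMk ((hψ 1).comp (by fun_prop))
  have h1 : (pairLaw p π x05 1).comap e s =
      (volume : Measure (Set.Icc (0:ℝ) 1)).map
        (fun t => (Sum.inl t, ψ 1 (Sum.inl (Sum.inl t)))) s := by
    rw [hterm, lintegral_histLaw_one hx0 π (hfψ 1), ← lintegral_indicator_one hs,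
      lintegral_map (measurable_one.indicator hs) hφ]
    simp only [hfe]
  have h2 : ∀ n, (pairLaw p π x05 (n + 2)).comap e s = 0 := fun n => by
    rw [hterm, lintegral_histLaw_add_two hx0 hΔ π n (hfψ _), hfdef, Set.indicator_of_notMem]
    rintro ⟨z, -, hz⟩
    simp [e] at hz
  rw [occupation, Measure.sum_apply _ hs, graphOccupation, Measure.add_apply,
    Measure.dirac_apply' _ hs, tsum_eq_sum (s := Finset.range 2)]
  · rw [Finset.sum_range_succ, Finset.sum_range_one, h0, h1]
  · intro n hn
    obtain ⟨m, rfl⟩ := Nat.exists_eq_add_of_le' (not_lt.1 (fun h => hn (Finset.mem_range.2 h)))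
    exact h2 m

instance (b : Bool) (φ : Set.Icc (0:ℝ) 1 → Bool) : IsFiniteMeasure (graphOccupation b φ) := by
  unfold graphOccupation; infer_instance

/-- The function on `Y × A` equal to `f` on `[0,1] × {1}` and to `0` elsewhere. -/
def testFunction (f : Set.Icc (0:ℝ) 1 → ℝ) (z : (Set.Icc (0:ℝ) 1 ⊕ Unit) × Bool) : ℝ :=
  Sum.elim f (fun _ => 0) z.1 * if z.2 then 1 else 0

theorem continuous_testFunction {f : Set.Icc (0:ℝ) 1 → ℝ} (hf : Continuous f) :
    Continuous (testFunction f) :=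
  ((hf.sumElim continuous_const).comp continuous_fst).mul
    ((continuous_of_discreteTopology (f := fun b : Bool => if b then (1:ℝ) else 0)).comp
      continuous_snd)

theorem abs_testFunction_le {f : Set.Icc (0:ℝ) 1 → ℝ} {C : ℝ} (hC : ∀ t, |f t| ≤ C)
    (z : (Set.Icc (0:ℝ) 1 ⊕ Unit) × Bool) : |testFunction f z| ≤ C := by
  have hC0 : 0 ≤ C := (abs_nonneg _).trans (hC ⟨0, by simp⟩)
  rcases z with ⟨t | _, _ | _⟩ <;> simp [testFunction, hC0, hC]

theorem measurable_testFunction {f : Set.Icc (0:ℝ) 1 → ℝ} (hf : Continuous f) :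
    Measurable (testFunction f) :=
  ((hf.measurable.sumElim measurable_const).comp measurable_fst).mul
    ((measurable_of_countable fun b : Bool => if b then (1:ℝ) else 0).comp measurable_snd)

theorem integral_testFunction_graphOccupation {f : Set.Icc (0:ℝ) 1 → ℝ} (hf : Continuous f)
    {C : ℝ} (hC : ∀ t, |f t| ≤ C) (b : Bool) {φ : Set.Icc (0:ℝ) 1 → Bool} (hφ : Measurable φ) :
    ∫ z, testFunction f z ∂(graphOccupation b φ) =
      ∫ t : Set.Icc (0:ℝ) 1, f t * if φ t then 1 else 0 := by
  have hm := measurable_testFunction hf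
  have hi : ∀ (μ : Measure ((Set.Icc (0:ℝ) 1 ⊕ Unit) × Bool)) [IsFiniteMeasure μ],
      Integrable (testFunction f) μ := fun μ _ =>
    Integrable.of_bound hm.aestronglyMeasurable C (.of_forall (abs_testFunction_le hC))
  rw [graphOccupation, integral_add_measure (hi _) (hi _), integral_dirac' _ _ hm.stronglyMeasurable,
    integral_map (measurable_inl.prodMk hφ).aemeasurable hm.aestronglyMeasurable]
  simp [testFunction]

/-- The actions on `[0,1]` selected by the square wave of frequency `k + 1`. -/
def squareWaveAction (k : ℕ) (t : ℝ) : Bool := decide (Even ⌊(k + 1 : ℝ) * t⌋)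

theorem measurable_squareWaveAction (k : ℕ) : Measurable (squareWaveAction k) :=
  (measurable_of_countable fun n : ℤ => decide (Even n)).comp
    (Int.measurable_floor.comp (measurable_const_mul _))

theorem ite_squareWaveAction (k : ℕ) (t : ℝ) :
    (if squareWaveAction k t then (1:ℝ) else 0) = 2⁻¹ * (1 + squareWave ((k + 1 : ℝ) * t)) := by
  by_cases h : Even ⌊(k + 1 : ℝ) * t⌋ <;> norm_num [squareWaveAction, squareWave, h]

theorem tendsto_integral_mul_squareWaveAction {f : Set.Icc (0:ℝ) 1 → ℝ} (hf : Continuous f)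
    {C : ℝ} (hC : ∀ t, |f t| ≤ C) :
    Tendsto (fun k : ℕ => ∫ t : Set.Icc (0:ℝ) 1, f t * if squareWaveAction k t then 1 else 0)
      atTop (𝓝 (2⁻¹ * ∫ t, f t)) := by
  set F : ℝ → ℝ := Set.IccExtend zero_le_one f
  have hFf : ∀ t : Set.Icc (0:ℝ) 1, F t = f t := fun t => Set.IccExtend_val _ f t
  have h := tendsto_integral_mul_squareWave (f := F) hf.Icc_extend' (fun x => hC _)
  have hfi : Integrable f := Integrable.of_bound hf.aestronglyMeasurable C (.of_forall hC)
  have hEq : ∀ k : ℕ, (∫ t : Set.Icc (0:ℝ) 1, f t * if squareWaveAction k t then 1 else 0) =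
      2⁻¹ * (∫ t, f t) +
        2⁻¹ * ∫ t in Set.Icc (0:ℝ) 1, F t * squareWave ((k + 1 : ℝ) * t) := by
    intro k
    have hw : Measurable fun t : Set.Icc (0:ℝ) 1 => squareWave ((k + 1 : ℝ) * t) :=
      measurable_squareWave.comp (measurable_subtype_coe.const_mul _)
    rw [← integral_subtype_comap measurableSet_Icc, ← mul_add]
    simp only [hFf]
    change _ = 2⁻¹ * (_ + ∫ t : Set.Icc (0:ℝ) 1, f t * squareWave ((k + 1 : ℝ) * t))
    rw [← integral_add hfi (hfi.mul_bdd (c := 1) hw.aestronglyMeasurable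
      (.of_forall fun t => by rw [Real.norm_eq_abs, abs_squareWave])), ← integral_const_mul]
    congr with t
    rw [ite_squareWaveAction]
    ring
  simp only [hEq]
  simpa using (h.const_mul 2⁻¹).const_add (2⁻¹ * ∫ t, f t)

theorem continuous_integral_wTop {Ω : Type*} [TopologicalSpace Ω] [MeasurableSpace Ω] {g : Ω → ℝ}
    (hg : Continuous g) (hb : ∃ C, ∀ z, |g z| ≤ C) :
    Continuous[wTop Ω, inferInstance] fun η : FiniteMeasure Ω => ∫ z, g z ∂(η : Measure Ω) :=
  continuous_iInf_dom (i := g) <| continuous_iInf_dom (i := hg) <|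
    continuous_iInf_dom (i := hb) continuous_induced_dom

theorem not_forall_integral_mul_ite_eq_half {φ : Set.Icc (0:ℝ) 1 → Bool} (hφ : Measurable φ) :
    ¬ ∀ f : BoundedContinuousFunction (Set.Icc (0:ℝ) 1) ℝ,
      (∫ t, f t * if φ t then 1 else 0) = 2⁻¹ * ∫ t, f t := by
  intro h
  set B : Set (Set.Icc (0:ℝ) 1) := φ ⁻¹' {true}
  have hB : MeasurableSet B := hφ (measurableSet_singleton true)
  have heq : (volume : Measure (Set.Icc (0:ℝ) 1)).restrict B = (2⁻¹ : NNReal) • volume := by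
    refine ext_of_forall_integral_eq_of_IsFiniteMeasure fun f => ?_
    rw [integral_smul_nnreal_measure, ← integral_indicator hB]
    refine Eq.trans ?_ (h f)
    congr with t
    by_cases ht : φ t = true <;> simp [B, ht]
  have hBc := congrArg (fun μ => μ Bᶜ) heq
  have hBB := congrArg (fun μ => μ B) heq
  have huniv : volume B + volume Bᶜ = 1 := by
    rw [measure_add_measure_compl hB, measure_univ]
  simp only [Measure.restrict_apply hB.compl, Set.compl_inter_self, measure_empty,
    Measure.smul_apply, Measure.restrict_apply_self] at hBc hBB
  have h0 : volume Bᶜ = 0 := by simpa using hBc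
  rw [h0, add_zero] at huniv
  rw [huniv] at hBB
  have := congrArg ENNReal.toReal hBB
  norm_num [ENNReal.smul_def] at this

/-- The deterministic Markov strategy playing the stationary rule `ψ`. -/
def stationaryStrategy (ψ : X5 → Bool) (hψ : Measurable ψ) : Strategy X5 Bool :=
  ⟨fun _ => Kernel.deterministic (fun h => ψ h.2) (hψ.comp measurable_snd),
    fun _ => inferInstance⟩

/-- The stationary rule which follows the square wave of frequency `k + 1` on `[0,1]`. -/
def squareWaveRule (k : ℕ) : X5 → Bool :=
  Sum.elim (Sum.elim (fun t => squareWaveAction k t) fun _ => false) fun _ => false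

theorem measurable_squareWaveRule (k : ℕ) : Measurable (squareWaveRule k) :=
  (((measurable_squareWaveAction k).comp measurable_subtype_coe).sumElim
    measurable_const).sumElim measurable_const

theorem not_isCompact_occSet
    (hx0 : ∀ a : Bool, p (x05, a) =
      (volume : Measure (Set.Icc (0:ℝ) 1)).map (fun t => (Sum.inl (Sum.inl t) : X5)))
    (hΔ : ∀ x : X5, x ≠ x05 → ∀ a : Bool, p (x, a) {(Sum.inr () : X5)} = 1) :
    ¬ @IsCompact _ (wTop ((↥(Set.Icc (0:ℝ) 1) ⊕ Unit) × Bool)) (OccSet p DetMarkov x05) := by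
  intro hK
  have hocc : ∀ k, occupation p (stationaryStrategy _ (measurable_squareWaveRule k)) x05 =
      graphOccupation false fun t => squareWaveAction k t := fun k =>
    occupation_eq_graphOccupation hx0 hΔ (ψ := fun _ => squareWaveRule k)
      (fun _ => measurable_squareWaveRule k)
      (fun n h => Kernel.deterministic_apply ((measurable_squareWaveRule k).comp measurable_snd) h)
  set u : ℕ → FiniteMeasure ((Set.Icc (0:ℝ) 1 ⊕ Unit) × Bool) := fun k =>
    ⟨graphOccupation false fun t => squareWaveAction k t, inferInstance⟩
  have hu : ∀ k, u k ∈ OccSet p DetMarkov x05 := fun k =>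
    ⟨stationaryStrategy _ (measurable_squareWaveRule k),
      fun n => ⟨squareWaveRule k, measurable_squareWaveRule k, fun h =>
        Kernel.deterministic_apply ((measurable_squareWaveRule k).comp measurable_snd) h⟩,
      (hocc k).symm⟩
  obtain ⟨η, ⟨π, hπ, hη⟩, hcl⟩ := @IsCompact.exists_mapClusterPt _ (wTop _) _ _ hK atTop _ u
    (Filter.tendsto_principal.2 (.of_forall hu))
  choose ψ hψ hπψ using hπ
  rw [occupation_eq_graphOccupation hx0 hΔ hψ hπψ] at hη
  have hφ : Measurable fun t : Set.Icc (0:ℝ) 1 => ψ 1 (Sum.inl (Sum.inl t)) :=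
    (hψ 1).comp (by fun_prop)
  refine not_forall_integral_mul_ite_eq_half hφ fun f => ?_
  have hC : ∀ t, |f t| ≤ ‖f‖ := f.norm_coe_le_norm
  have hlim : Tendsto (fun k => ∫ z, testFunction f z ∂(u k : Measure _)) atTop
      (𝓝 (2⁻¹ * ∫ t, f t)) :=
    (tendsto_integral_mul_squareWaveAction f.continuous hC).congr fun k =>
      (integral_testFunction_graphOccupation f.continuous hC _
        ((measurable_squareWaveAction k).comp measurable_subtype_coe)).symm
  have hcont := continuous_integral_wTop (continuous_testFunction f.continuous)
    ⟨‖f‖, abs_testFunction_le hC⟩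
  have hcl' : MapClusterPt (∫ z, testFunction f z ∂(η : Measure _)) atTop
      (fun k => ∫ z, testFunction f z ∂(u k : Measure _)) :=
    letI : TopologicalSpace (FiniteMeasure ((Set.Icc (0:ℝ) 1 ⊕ Unit) × Bool)) := wTop _
    hcl.continuousAt_comp hcont.continuousAt
  have hnb : (𝓝 (∫ z, testFunction f z ∂(η : Measure _)) ⊓ 𝓝 (2⁻¹ * ∫ t, f t)).NeBot :=
    hcl'.neBot.mono (inf_le_inf_left _ hlim)
  rw [← eq_of_nhds_neBot hnb, hη, integral_testFunction_graphOccupation f.continuous hC _ hφ]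

theorem isAbsorbing_of_survive_add_two
    (h : ∀ (π : Strategy X5 Bool) (n : ℕ), survive p π x05 (n + 2) = 0) :
    IsAbsorbing p x05 := by
  intro π
  rw [tsum_eq_sum (s := Finset.range 2)]
  · exact ENNReal.sum_lt_top.2 fun n _ => (survive_le_one π n).trans_lt ENNReal.one_lt_top
  · intro n hn
    obtain ⟨m, rfl⟩ := Nat.exists_eq_add_of_le' (not_lt.1 (fun h => hn (Finset.mem_range.2 h)))
    exact h π m

end Example

/-- Remark 1 of the paper.  The MDP model with `Y = [0,1] ∪ {x₀}`
(`x₀` isolated), `A = {0,1}` discrete, `p(·|x₀,a) = Leb` on `[0,1]`, and `p({Δ}|x,a) = 1`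
for `x ∈ [0,1]`, satisfies Condition (S) and is uniformly absorbing with initial state `x₀`
(hence `Π_DM`-uniformly absorbing), yet `D^{Π_DM}_{x₀}` is not w-compact in `M(Y × A)`. -/
theorem stmt5
    (p : Kernel (X5 × Bool) X5) [IsMarkovKernel p]
    (hx0 : ∀ a : Bool, p (x05, a) =
      ((volume : Measure ℝ).comap (Subtype.val : ↥(Set.Icc (0:ℝ) 1) → ℝ)).map
        (fun t => (Sum.inl (Sum.inl t) : X5)))
    (hIcc : ∀ (t : ↥(Set.Icc (0:ℝ) 1)) (a : Bool),
      p (Sum.inl (Sum.inl t), a) {(Sum.inr () : X5)} = 1)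
    (hcem : ∀ a : Bool, p ((Sum.inr () : X5), a) {(Sum.inr () : X5)} = 1) :
    ConditionS p ∧
      IsAbsorbing p x05 ∧
      IsUnifAbsorbing p Set.univ x05 ∧
      IsUnifAbsorbing p DetMarkov x05 ∧
      ¬ @IsCompact _ (wTop ((↥(Set.Icc (0:ℝ) 1) ⊕ Unit) × Bool))
          (OccSet p DetMarkov x05) := by
  have hΔ : ∀ x : X5, x ≠ x05 → ∀ a : Bool, p (x, a) {(Sum.inr () : X5)} = 1 :=
    fun _ hx => singleton_cemetery_eq_one hIcc hcem hx
  have hs := survive_add_two hx0 hΔ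
  exact ⟨⟨inferInstance, fun _ _ _ _ => continuous_of_discreteTopology⟩,
    isAbsorbing_of_survive_add_two hs, isUnifAbsorbing_of_survive_add_two hs _,
    isUnifAbsorbing_of_survive_add_two hs _, not_isCompact_occSet hx0 hΔ⟩

end
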